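/- There is a constant C depending only on the dimension N such that the following holds. Let K ≥ 0 and let f : ℝ^N → ℝ be smooth with ∇²f(v,v) ≥ −(N−1)K|v|² for all vectors v. Let α ≥ 1, let q be a smooth function on ℝ^N × [0,∞) with ‖q⁺‖_∞ < ∞ and ‖∇q‖_∞ < ∞, and let u be a smooth positive solution of ∂ₜu = Δ_f u + q·u^α on ℝ^N × [0,∞) with u ≤ D everywhere, for some constant D > 0. Set λ := max{ √α·D^{(α−1)/2}·‖q⁺‖_∞^{1/2}, D^{(α−1)/3}·‖∇q‖_∞^{1/3} }. Then for all x, y ∈ ℝ^N and all t > 0, with Γ := exp(−C·(1/√t + √K + λ)·|x−y|), one has u(y,t) ≤ u(x,t)^Γ · (D·e)^{1−Γ}. -/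

import Mathlib

open Real Set Metric Filter
open scoped RealInnerProductSpace Topology

noncomputable section

/-- The Hessian of `f : ℝ^N → ℝ` at `x`, evaluated on the pair of vectors `(v, w)`. -/
def hess {N : ℕ} (f : EuclideanSpace ℝ (Fin N) → ℝ) (x v w : EuclideanSpace ℝ (Fin N)) : ℝ :=
  ⟪fderiv ℝ (gradient f) x v, w⟫

/-- The Laplacian of `f : ℝ^N → ℝ` at `x` (trace of the Hessian). -/
def lap {N : ℕ} (f : EuclideanSpace ℝ (Fin N) → ℝ) (x : EuclideanSpace ℝ (Fin N)) : ℝ :=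
  ∑ i, hess f x (EuclideanSpace.single i 1) (EuclideanSpace.single i 1)

/-- The weighted (drift) Laplacian `Δ_f u = Δ u − ⟨∇f, ∇u⟩`. -/
def wlap {N : ℕ} (f u : EuclideanSpace ℝ (Fin N) → ℝ) (x : EuclideanSpace ℝ (Fin N)) : ℝ :=
  lap u x - ⟪gradient f x, gradient u x⟫

/-- Spatial gradient of a space-time function. -/
def sgrad {N : ℕ} (u : EuclideanSpace ℝ (Fin N) × ℝ → ℝ) (p : EuclideanSpace ℝ (Fin N) × ℝ) :
    EuclideanSpace ℝ (Fin N) :=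
  gradient (fun y => u (y, p.2)) p.1

/-- Spatial weighted Laplacian `Δ_f u(·,t)` of a space-time function. -/
def swlap {N : ℕ} (f : EuclideanSpace ℝ (Fin N) → ℝ) (u : EuclideanSpace ℝ (Fin N) × ℝ → ℝ)
    (p : EuclideanSpace ℝ (Fin N) × ℝ) : ℝ :=
  wlap f (fun y => u (y, p.2)) p.1

/-- Time derivative `∂ₜ u` of a space-time function. -/
def tderiv {N : ℕ} (u : EuclideanSpace ℝ (Fin N) × ℝ → ℝ) (p : EuclideanSpace ℝ (Fin N) × ℝ) : ℝ :=
  deriv (fun s => u (p.1, s)) p.2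

/-- The parabolic cylinder `Q_{R,T} = B̄(x₀,R) × [t₀ − T, t₀]`. -/
def cyl {N : ℕ} (x₀ : EuclideanSpace ℝ (Fin N)) (R t₀ T : ℝ) :
    Set (EuclideanSpace ℝ (Fin N) × ℝ) :=
  (closedBall x₀ R) ×ˢ (Icc (t₀ - T) t₀)

/-- `μ := max_{|x−x₀|=1} ((N−1) − ⟨∇f(x), x−x₀⟩)`. -/
def muConst {N : ℕ} (f : EuclideanSpace ℝ (Fin N) → ℝ) (x₀ : EuclideanSpace ℝ (Fin N)) : ℝ :=
  sSup ((fun x => ((N : ℝ) - 1) - ⟪gradient f x, x - x₀⟫) '' sphere x₀ 1)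

/-- The space-time half space `ℝ^N × [0, ∞)`. -/
def halfSpace (N : ℕ) : Set (EuclideanSpace ℝ (Fin N) × ℝ) := {p | 0 ≤ p.2}

/-- `‖q⁺‖_{L^∞(ℝ^N × [0,∞))}`. -/
def qplusSup {N : ℕ} (q : EuclideanSpace ℝ (Fin N) × ℝ → ℝ) : ℝ :=
  sSup ((fun p => max (q p) 0) '' halfSpace N)

/-- `‖∇q‖_{L^∞(ℝ^N × [0,∞))}` (spatial gradient). -/
def qgradSup {N : ℕ} (q : EuclideanSpace ℝ (Fin N) × ℝ → ℝ) : ℝ :=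
  sSup ((fun p => ‖sgrad q p‖) '' halfSpace N)

section aux

/-- Directional derivative as an operator on functions. -/
def dd {V : Type*} [NormedAddCommGroup V] [NormedSpace ℝ V] (v : V) (u : V → ℝ) (p : V) : ℝ :=
  fderiv ℝ u p v

lemma dd_contDiff {V : Type*} [NormedAddCommGroup V] [NormedSpace ℝ V] (v : V) {u : V → ℝ}
    (hu : ContDiff ℝ (⊤ : ℕ∞) u) : ContDiff ℝ (⊤ : ℕ∞) (dd v u) := by
  unfold dd
  exact (hu.fderiv_right (m := (⊤ : ℕ∞)) (by simp)).clm_apply contDiff_const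

lemma dd_comm {V : Type*} [NormedAddCommGroup V] [NormedSpace ℝ V] (v w : V) {u : V → ℝ}
    (hu : ContDiff ℝ (⊤ : ℕ∞) u) : dd v (dd w u) = dd w (dd v u) := by
  funext p
  have hd : Differentiable ℝ (fderiv ℝ u) :=
    (hu.fderiv_right (m := (⊤ : ℕ∞)) (by simp)).differentiable (by simp)
  have key : ∀ v w : V, dd v (dd w u) p = fderiv ℝ (fderiv ℝ u) p v w := by
    intro v w
    unfold dd
    rw [fderiv_clm_apply (hd p) (differentiableAt_const w)]
    simp
  rw [key, key]
  have := (hu.contDiffAt (x := p)).isSymmSndFDerivAt (n := (⊤ : ℕ∞)) (by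
    simp only [minSmoothness_of_isRCLikeNormedField]
    exact WithTop.coe_le_coe.2 (le_top : (2 : ℕ∞) ≤ ⊤))
  exact this v w

lemma dd_line {V : Type*} [NormedAddCommGroup V] [NormedSpace ℝ V] (v p : V) {u : V → ℝ}
    (hu : ContDiff ℝ (⊤ : ℕ∞) u) (s : ℝ) :
    HasDerivAt (fun s : ℝ => u (p + s • v)) (dd v u (p + s • v)) s := by
  have h1 : HasFDerivAt u (fderiv ℝ u (p + s • v)) (p + s • v) :=
    (hu.differentiable (by simp) _).hasFDerivAt
  have h2 : HasDerivAt (fun s : ℝ => p + s • v) v s := by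
    simpa using ((hasDerivAt_id s).smul_const v).const_add p
  exact h1.comp_hasDerivAt s h2

variable {N : ℕ}

lemma slice_contDiff {u : EuclideanSpace ℝ (Fin N) × ℝ → ℝ} (hu : ContDiff ℝ (⊤ : ℕ∞) u) (t : ℝ) :
    ContDiff ℝ (⊤ : ℕ∞) (fun y => u (y, t)) :=
  hu.comp (contDiff_id.prodMk contDiff_const)

lemma inner_grad_slice {u : EuclideanSpace ℝ (Fin N) × ℝ → ℝ} (hu : ContDiff ℝ (⊤ : ℕ∞) u)
    (x v : EuclideanSpace ℝ (Fin N)) (t : ℝ) :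
    ⟪gradient (fun y => u (y, t)) x, v⟫ = dd (v, (0 : ℝ)) u (x, t) := by
  unfold gradient dd
  rw [InnerProductSpace.toDual_symm_apply]
  have h1 : HasFDerivAt u (fderiv ℝ u (x, t)) (x, t) :=
    (hu.differentiable (by simp) _).hasFDerivAt
  have h2 : HasFDerivAt (fun y : EuclideanSpace ℝ (Fin N) => (y, t))
    (ContinuousLinearMap.inl ℝ (EuclideanSpace ℝ (Fin N)) ℝ) x := hasFDerivAt_prodMk_left x t
  have := (h1.comp x h2).fderiv
  change fderiv ℝ (u ∘ fun y => (y, t)) x v = _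
  rw [this]; simp

lemma inner_sgrad {u : EuclideanSpace ℝ (Fin N) × ℝ → ℝ} (hu : ContDiff ℝ (⊤ : ℕ∞) u)
    (p : EuclideanSpace ℝ (Fin N) × ℝ) (v : EuclideanSpace ℝ (Fin N)) :
    ⟪sgrad u p, v⟫ = dd (v, (0 : ℝ)) u p := inner_grad_slice hu p.1 v p.2

lemma gradient_contDiff {f : EuclideanSpace ℝ (Fin N) → ℝ} (hf : ContDiff ℝ (⊤ : ℕ∞) f) :
    ContDiff ℝ (⊤ : ℕ∞) (gradient f) := by
  unfold gradient
  exact (InnerProductSpace.toDual ℝ (EuclideanSpace ℝ (Fin N))).symm.contDiff.comp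
    (hf.fderiv_right (m := (⊤ : ℕ∞)) (by simp))

lemma hess_slice {u : EuclideanSpace ℝ (Fin N) × ℝ → ℝ} (hu : ContDiff ℝ (⊤ : ℕ∞) u)
    (x v w : EuclideanSpace ℝ (Fin N)) (t : ℝ) :
    hess (fun y => u (y, t)) x v w = dd (v, (0 : ℝ)) (dd (w, (0 : ℝ)) u) (x, t) := by
  unfold hess
  have hd := (gradient_contDiff (slice_contDiff hu t)).differentiable (by simp) x
  have h1 : (fun y => ⟪gradient (fun y => u (y, t)) y, w⟫)
      = fun y => dd (w, (0 : ℝ)) u (y, t) := by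
    funext y; exact inner_grad_slice hu y w t
  have h2 := fderiv_inner_apply ℝ hd (differentiableAt_const w) v
  rw [h1] at h2
  simp only [fderiv_fun_const, Pi.zero_apply, _root_.zero_apply, inner_zero_right,
    zero_add] at h2
  rw [← h2]
  have h3 := inner_grad_slice (dd_contDiff (w, (0 : ℝ)) hu) x v t
  rw [← h3]
  unfold gradient
  rw [InnerProductSpace.toDual_symm_apply]

lemma tderiv_eq {u : EuclideanSpace ℝ (Fin N) × ℝ → ℝ} (hu : ContDiff ℝ (⊤ : ℕ∞) u)
    (p : EuclideanSpace ℝ (Fin N) × ℝ) : tderiv u p = dd (0, (1 : ℝ)) u p := by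
  unfold tderiv dd
  have h1 : HasFDerivAt u (fderiv ℝ u (p.1, p.2)) (p.1, p.2) :=
    (hu.differentiable (by simp) _).hasFDerivAt
  have h2 : HasDerivAt (fun s : ℝ => (p.1, s)) (0, (1 : ℝ)) p.2 :=
    (hasDerivAt_const _ _).prodMk (hasDerivAt_id _)
  exact (h1.comp_hasDerivAt _ h2).deriv

/-- coordinate direction in space-time -/
def ee (N : ℕ) (i : Fin N) : EuclideanSpace ℝ (Fin N) × ℝ := (EuclideanSpace.single i 1, 0)

lemma inner_coord_sum (a b : EuclideanSpace ℝ (Fin N)) : ⟪a, b⟫ =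
    ∑ i, ⟪a, EuclideanSpace.single i 1⟫ * ⟪b, EuclideanSpace.single i (1 : ℝ)⟫ := by
  simp [PiLp.inner_apply, mul_comm]

lemma sgrad_continuous {u : EuclideanSpace ℝ (Fin N) × ℝ → ℝ} (hu : ContDiff ℝ (⊤ : ℕ∞) u) :
    Continuous (sgrad u) := by
  have : sgrad u = fun p => (InnerProductSpace.toDual ℝ (EuclideanSpace ℝ (Fin N))).symm
      ((fderiv ℝ u p).comp (ContinuousLinearMap.inl ℝ (EuclideanSpace ℝ (Fin N)) ℝ)) := by
    funext p
    refine ext_inner_right ℝ fun v => ?_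
    rw [inner_sgrad hu, InnerProductSpace.toDual_symm_apply]
    simp [dd]
  rw [this]
  refine (LinearIsometryEquiv.continuous _).comp ?_
  exact (hu.continuous_fderiv (by simp)).clm_comp continuous_const

/-- The PDE in terms of directional derivatives. -/
lemma pde_dd {f : EuclideanSpace ℝ (Fin N) → ℝ} (hf : ContDiff ℝ (⊤ : ℕ∞) f)
    {u : EuclideanSpace ℝ (Fin N) × ℝ → ℝ} (hu : ContDiff ℝ (⊤ : ℕ∞) u)
    (p : EuclideanSpace ℝ (Fin N) × ℝ) :
    swlap f u p = ∑ i, dd (ee N i) (dd (ee N i) u) p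
      - ∑ i, dd (ee N i) (fun z => f z.1) p * dd (ee N i) u p := by
  unfold swlap wlap lap
  have hF : ContDiff ℝ (⊤ : ℕ∞) (fun z : EuclideanSpace ℝ (Fin N) × ℝ => f z.1) :=
    hf.comp contDiff_fst
  congr 1
  · refine Finset.sum_congr rfl fun i _ => ?_
    exact hess_slice hu _ _ _ _
  · rw [inner_coord_sum]
    refine Finset.sum_congr rfl fun i _ => ?_
    congr 1
    · exact inner_grad_slice hF p.1 _ p.2
    · exact inner_grad_slice hu p.1 _ p.2

/-- The differentiated PDE. -/
lemma pde_diff {F q u : EuclideanSpace ℝ (Fin N) × ℝ → ℝ} (hF : ContDiff ℝ (⊤ : ℕ∞) F)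
    (hq : ContDiff ℝ (⊤ : ℕ∞) q) (hu : ContDiff ℝ (⊤ : ℕ∞) u) {α : ℝ}
    (hpos : ∀ p ∈ halfSpace N, 0 < u p)
    (hpde : ∀ p ∈ halfSpace N, dd (0, (1 : ℝ)) u p = ∑ i, dd (ee N i) (dd (ee N i) u) p
      - ∑ i, dd (ee N i) F p * dd (ee N i) u p + q p * u p ^ α)
    (e : EuclideanSpace ℝ (Fin N)) (p : EuclideanSpace ℝ (Fin N) × ℝ) (hp : p ∈ halfSpace N) :
    dd (0, (1 : ℝ)) (dd (e, (0 : ℝ)) u) p =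
      ∑ i, dd (ee N i) (dd (ee N i) (dd (e, (0 : ℝ)) u)) p
      - ∑ i, (dd (e, (0 : ℝ)) (dd (ee N i) F) p * dd (ee N i) u p
          + dd (ee N i) F p * dd (ee N i) (dd (e, (0 : ℝ)) u) p)
      + (dd (e, (0 : ℝ)) q p * u p ^ α + q p * (dd (e, (0 : ℝ)) u p * α * u p ^ (α - 1))) := by
  set v : EuclideanSpace ℝ (Fin N) × ℝ := (e, (0 : ℝ)) with hv
  have hps : ∀ s : ℝ, p + s • v ∈ halfSpace N := by
    intro s
    simpa [halfSpace, hv] using hp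
  have hfun : (fun s : ℝ => dd (0, (1 : ℝ)) u (p + s • v)) = fun s : ℝ =>
      ∑ i, dd (ee N i) (dd (ee N i) u) (p + s • v)
      - ∑ i, dd (ee N i) F (p + s • v) * dd (ee N i) u (p + s • v)
      + q (p + s • v) * u (p + s • v) ^ α := by
    funext s; exact hpde _ (hps s)
  have h0 := dd_line v p (dd_contDiff (0, (1 : ℝ)) hu) 0
  rw [hfun] at h0
  have h1 : HasDerivAt (fun s : ℝ => ∑ i, dd (ee N i) (dd (ee N i) u) (p + s • v))
      (∑ i, dd v (dd (ee N i) (dd (ee N i) u)) (p + (0 : ℝ) • v)) 0 :=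
    HasDerivAt.fun_sum fun i _ => dd_line v p (dd_contDiff _ (dd_contDiff _ hu)) 0
  have h2 : HasDerivAt (fun s : ℝ => ∑ i, dd (ee N i) F (p + s • v) * dd (ee N i) u (p + s • v))
      (∑ i, (dd v (dd (ee N i) F) (p + (0 : ℝ) • v) * dd (ee N i) u (p + (0 : ℝ) • v)
        + dd (ee N i) F (p + (0 : ℝ) • v) * dd v (dd (ee N i) u) (p + (0 : ℝ) • v))) 0 :=
    HasDerivAt.fun_sum fun i _ => (dd_line v p (dd_contDiff _ hF) 0).mul
      (dd_line v p (dd_contDiff _ hu) 0)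
  have h3 := (dd_line v p hq 0).mul ((dd_line v p hu 0).rpow_const (p := α)
    (Or.inl (hpos _ (hps 0)).ne'))
  have h4 := h0.unique ((h1.sub h2).add h3)
  simp only [zero_smul, add_zero] at h4
  rw [dd_comm _ v hu, h4]
  congr 2
  · refine Finset.sum_congr rfl fun i _ => ?_
    rw [dd_comm v _ (dd_contDiff _ hu), dd_comm v _ hu]
  · refine Finset.sum_congr rfl fun i _ => ?_
    rw [dd_comm v _ hu]

end aux
section oned

lemma second_test {φ φ1 : ℝ → ℝ} {c : ℝ} (h1 : ∀ᶠ s in 𝓝 (0 : ℝ), HasDerivAt φ (φ1 s) s)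
    (h2 : HasDerivAt φ1 c 0) (hm : IsLocalMax φ 0) : φ1 0 = 0 ∧ c ≤ 0 := by
  have h0 : φ1 0 = 0 := hm.hasDerivAt_eq_zero h1.self_of_nhds
  refine ⟨h0, ?_⟩
  by_contra hc
  push Not at hc
  have hd : deriv φ =ᶠ[𝓝 0] φ1 := h1.mono fun s hs => hs.deriv
  have hdd : deriv (deriv φ) 0 = c := by rw [hd.deriv_eq, h2.deriv]
  have hmin : IsLocalMin φ 0 := isLocalMin_of_deriv_deriv_pos (by rw [hdd]; exact hc)
    (by rw [hd.eq_of_nhds, h0]) h1.self_of_nhds.continuousAt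
  have hconst : φ =ᶠ[𝓝 0] fun _ => φ 0 := by
    filter_upwards [hm, hmin] with s a b using le_antisymm a b
  have h3 : deriv φ =ᶠ[𝓝 0] fun _ => 0 := by
    have := hconst.deriv
    simpa using this
  have : deriv (deriv φ) 0 = 0 := by rw [h3.deriv_eq]; simp
  linarith

lemma left_test {φ : ℝ → ℝ} {c t : ℝ} (h1 : HasDerivAt φ c t)
    (hm : ∀ᶠ s in 𝓝[<] t, φ s ≤ φ t) : 0 ≤ c := by
  have h2 : Tendsto (slope φ t) (𝓝[<] t) (𝓝 c) :=
    (hasDerivAt_iff_tendsto_slope.1 h1).mono_left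
      (nhdsWithin_mono _ fun s hs => ne_of_lt hs)
  refine ge_of_tendsto h2 ?_
  filter_upwards [hm, self_mem_nhdsWithin] with s hs hst
  rw [slope_def_field]
  exact div_nonneg_of_nonpos (by linarith) (by linarith [show s < t from hst])

lemma touch {A A1 S S1 w w1 : ℝ → ℝ} {A2 S2 w2 L : ℝ}
    (hA : ∀ s, HasDerivAt A (A1 s) s) (hA1 : HasDerivAt A1 A2 0)
    (hS : ∀ᶠ s in 𝓝 (0 : ℝ), HasDerivAt S (S1 s) s) (hS1 : HasDerivAt S1 S2 0)
    (hw : ∀ s, HasDerivAt w (w1 s) s) (hw1 : HasDerivAt w1 w2 0) (hpos : 0 < w 0)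
    (hm : IsLocalMax (fun s => A s - S s * (w s * (1 + L - Real.log (w s)))) 0) :
    A1 0 = S1 0 * (w 0 * (1 + L - Real.log (w 0))) + S 0 * ((L - Real.log (w 0)) * w1 0) ∧
    A2 - S2 * (w 0 * (1 + L - Real.log (w 0))) - 2 * S1 0 * ((L - Real.log (w 0)) * w1 0)
      - S 0 * ((L - Real.log (w 0)) * w2 - w1 0 ^ 2 / w 0) ≤ 0 := by
  have hwp : ∀ᶠ s in 𝓝 (0 : ℝ), 0 < w s := (hw 0).continuousAt.eventually (lt_mem_nhds hpos)
  have hk : ∀ s, 0 < w s → HasDerivAt (fun s => w s * (1 + L - Real.log (w s)))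
      ((L - Real.log (w s)) * w1 s) s := by
    intro s hs
    have := (hw s).mul (((hw s).log hs.ne').const_sub (1 + L))
    refine this.congr_deriv ?_
    field_simp
    ring
  have hk2 : HasDerivAt (fun s => (L - Real.log (w s)) * w1 s)
      ((L - Real.log (w 0)) * w2 - w1 0 ^ 2 / w 0) 0 := by
    have := (((hw 0).log hpos.ne').const_sub L).mul hw1
    refine this.congr_deriv ?_
    field_simp
    ring
  have h := second_test (φ1 := fun s => A1 s - (S1 s * (w s * (1 + L - Real.log (w s)))
      + S s * ((L - Real.log (w s)) * w1 s)))
    (c := A2 - ((S2 * (w 0 * (1 + L - Real.log (w 0))) + S1 0 * ((L - Real.log (w 0)) * w1 0))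
      + (S1 0 * ((L - Real.log (w 0)) * w1 0)
        + S 0 * ((L - Real.log (w 0)) * w2 - w1 0 ^ 2 / w 0))))
    (by
      filter_upwards [hwp, hS] with s h1 h2
      exact (hA s).sub (h2.mul (hk s h1)))
    (hA1.sub ((hS1.mul (hk 0 hpos)).add (hS.self_of_nhds.mul hk2))) hm
  obtain ⟨h1, h2⟩ := h
  constructor
  · linarith
  · linarith

/-- derivatives of the barrier along a coordinate line -/
lemma barrier_deriv {τ R r2 c : ℝ} (hR : 0 < R) (hδ : 0 < 1 - r2 / R ^ 2) :
    (∀ᶠ s in 𝓝 (0 : ℝ), HasDerivAt (fun s : ℝ => τ / (1 - (r2 + 2 * s * c + s ^ 2) / R ^ 2))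
      (τ * ((2 * c + 2 * s) / R ^ 2) / (1 - (r2 + 2 * s * c + s ^ 2) / R ^ 2) ^ 2) s) ∧
    HasDerivAt (fun s : ℝ => τ * ((2 * c + 2 * s) / R ^ 2)
        / (1 - (r2 + 2 * s * c + s ^ 2) / R ^ 2) ^ 2)
      (τ * (2 / R ^ 2 / (1 - r2 / R ^ 2) ^ 2 + 8 * c ^ 2 / R ^ 4 / (1 - r2 / R ^ 2) ^ 3)) 0 := by
  have hd : ∀ s : ℝ, HasDerivAt (fun s : ℝ => 1 - (r2 + 2 * s * c + s ^ 2) / R ^ 2)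
      (-((2 * c + 2 * s) / R ^ 2)) s := by
    intro s
    have h1 : HasDerivAt (fun s : ℝ => r2 + 2 * s * c + s ^ 2) (2 * c + 2 * s) s := by
      have := ((((hasDerivAt_id s).const_mul 2).mul_const c).const_add r2).add
        ((hasDerivAt_id s).pow 2)
      refine this.congr_deriv ?_
      simp
    exact (h1.div_const _).const_sub 1
  have hn : ∀ᶠ s in 𝓝 (0 : ℝ), 0 < 1 - (r2 + 2 * s * c + s ^ 2) / R ^ 2 :=
    (hd 0).continuousAt.eventually (lt_mem_nhds (by simpa using hδ))
  constructor
  · filter_upwards [hn] with s hs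
    have := (hasDerivAt_const s τ).div (hd s) hs.ne'
    refine this.congr_deriv ?_
    simp
  · have h1 : HasDerivAt (fun s : ℝ => τ * ((2 * c + 2 * s) / R ^ 2)) (τ * (2 / R ^ 2)) 0 := by
      have := ((((hasDerivAt_id (0 : ℝ)).const_mul 2).const_add (2 * c)).div_const
        (R ^ 2)).const_mul τ
      simpa using this
    have hδ' : (1 - (r2 + 2 * (0 : ℝ) * c + 0 ^ 2) / R ^ 2) ≠ 0 := by
      simpa using hδ.ne'
    have := h1.div ((hd 0).pow 2) (pow_ne_zero 2 hδ')
    refine this.congr_deriv ?_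
    have hδ2 := hδ.ne'
    simp
    generalize 1 - r2 / R ^ 2 = d at *
    field_simp
    ring

set_option maxHeartbeats 2000000 in
/-- final numeric contradiction -/
lemma numeric {n k K lam a R τ δ S h r G Lf St : ℝ} (hn : 0 ≤ n) (hG : 0 ≤ G)
    (hkK : 0 ≤ k * K) (hlam : 0 ≤ lam) (ha : 0 < a) (hR : 1 ≤ R) (hr : 0 ≤ r) (hrR : r ≤ R)
    (hδ : 0 < δ) (hδ1 : δ ≤ 1) (hS : S = τ / δ) (hτ : a ≤ τ) (hh : 1 ≤ h)
    (haK : 24 * (k * K) ≤ a ^ 2) (hal : 4 * lam ≤ a) (haR : 16 ≤ a * R)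
    (haG : 8 * (2 * n + 8 + 2 * G) ≤ a ^ 2 * R)
    (hLf : Lf ≤ τ * ((2 * n + 2 * (G * r) + 2 * (k * K * r ^ 2)) / R ^ 2 / δ ^ 2
      + 8 * r ^ 2 / R ^ 4 / δ ^ 3))
    (hSt : -St ≤ S ^ 3 / 8)
    (hmain : 0 ≤ Lf - St + 2 * (h - 1) * (τ * (2 * r / R ^ 2) / δ ^ 2) * S - S ^ 3 * h
      + k * K * S + lam ^ 3 + lam ^ 2 * S) : False := by
  have hτ0 : 0 < τ := lt_of_lt_of_le ha hτ
  have hR0 : 0 < R := by linarith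
  have hS0 : 0 < S := by rw [hS]; positivity
  have hSτ : τ ≤ S := by rw [hS, le_div_iff₀ hδ]; nlinarith
  have hSa : a ≤ S := hτ.trans hSτ
  have hδS : δ = τ / S := by rw [hS]; field_simp
  have hS3 : 0 < S ^ 3 := by positivity
  -- gradient term
  have hrR2 : r / R ^ 2 ≤ a / 16 := by
    rw [div_le_iff₀ (by positivity)]
    nlinarith
  have g1 : 2 * (h - 1) * (τ * (2 * r / R ^ 2) / δ ^ 2) * S ≤ h * S ^ 3 / 4 := by
    have e1 : 2 * (h - 1) * (τ * (2 * r / R ^ 2) / δ ^ 2) * S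
        = 4 * (h - 1) * (r / R ^ 2 / τ) * S ^ 3 := by
      rw [hδS]; field_simp; ring
    rw [e1]
    have e2 : r / R ^ 2 / τ ≤ 1 / 16 := by
      rw [div_le_iff₀ hτ0]; linarith
    have e3 : 0 ≤ r / R ^ 2 / τ := by positivity
    have e4 : 4 * (h - 1) * (r / R ^ 2 / τ) ≤ h / 4 := by nlinarith
    nlinarith
  -- Laplacian term
  have g2 : τ * ((2 * n + 2 * (G * r) + 2 * (k * K * r ^ 2)) / R ^ 2 / δ ^ 2
      + 8 * r ^ 2 / R ^ 4 / δ ^ 3) ≤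
      S ^ 3 * (((2 * n + 8 + 2 * G) / R + 2 * (k * K)) / a ^ 2) := by
    have b1 : (2 * n + 2 * (G * r) + 2 * (k * K * r ^ 2)) / R ^ 2
        ≤ (2 * n + 2 * G) / R + 2 * (k * K) := by
      rw [div_le_iff₀ (by positivity)]
      have : ((2 * n + 2 * G) / R + 2 * (k * K)) * R ^ 2
        = (2 * n + 2 * G) * R + 2 * (k * K) * R ^ 2 := by field_simp
      rw [this]
      have : G * r ≤ G * R := by gcongr
      have : k * K * r ^ 2 ≤ k * K * R ^ 2 := by gcongr
      nlinarith
    have b2 : 8 * r ^ 2 / R ^ 4 ≤ 8 / R := by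
      rw [div_le_div_iff₀ (by positivity) hR0]
      have : r ^ 2 ≤ R ^ 2 := by gcongr
      have : R ^ 2 * R ≤ R ^ 4 := by
        have : R ^ 4 = R ^ 2 * R * R := by ring
        rw [this]
        exact le_mul_of_one_le_right (by positivity) hR
      nlinarith
    have b3 : (1 : ℝ) / δ ^ 2 ≤ 1 / δ ^ 3 := by
      apply one_div_le_one_div_of_le (by positivity)
      exact pow_le_pow_of_le_one hδ.le hδ1 (by norm_num)
    set X := (2 * n + 2 * G) / R + 2 * (k * K) with hX
    have hX0 : 0 ≤ X := by positivity
    calc τ * ((2 * n + 2 * (G * r) + 2 * (k * K * r ^ 2)) / R ^ 2 / δ ^ 2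
      + 8 * r ^ 2 / R ^ 4 / δ ^ 3) ≤ τ * (X / δ ^ 2 + 8 / R / δ ^ 3) := by gcongr
      _ ≤ τ * (X / δ ^ 3 + 8 / R / δ ^ 3) := by
        have : X / δ ^ 2 ≤ X / δ ^ 3 := by
          have := mul_le_mul_of_nonneg_left b3 hX0
          rwa [mul_one_div, mul_one_div] at this
        gcongr
      _ = S ^ 3 * ((X + 8 / R) / τ ^ 2) := by rw [hδS]; field_simp
      _ ≤ S ^ 3 * ((X + 8 / R) / a ^ 2) := by
        have hY : 0 ≤ X + 8 / R := by positivity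
        have hsq : a ^ 2 ≤ τ ^ 2 := pow_le_pow_left₀ ha.le hτ 2
        exact mul_le_mul_of_nonneg_left (div_le_div_of_nonneg_left hY (by positivity) hsq) hS3.le
      _ = _ := by rw [hX]; ring
  have g3 : ((2 * n + 8 + 2 * G) / R + 2 * (k * K)) / a ^ 2 + k * K / a ^ 2 ≤ 1 / 4 := by
    rw [← add_div, div_le_iff₀ (by positivity)]
    have : (2 * n + 8 + 2 * G) / R ≤ a ^ 2 / 8 := by
      rw [div_le_iff₀ hR0]; linarith
    linarith
  have g4 : k * K * S ≤ S ^ 3 * (k * K / a ^ 2) := by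
    have : S ^ 3 * (k * K / a ^ 2) = k * K * S * (S ^ 2 / a ^ 2) := by ring
    rw [this]
    apply le_mul_of_one_le_right (by positivity)
    rw [one_le_div (by positivity)]
    gcongr
  have hl : lam ≤ S / 4 := by linarith
  have g5 : lam ^ 3 ≤ S ^ 3 / 64 := by
    calc lam ^ 3 ≤ (S / 4) ^ 3 := by gcongr
      _ = _ := by ring
  have g6 : lam ^ 2 * S ≤ S ^ 3 / 16 := by
    calc lam ^ 2 * S ≤ (S / 4) ^ 2 * S := by gcongr
      _ = _ := by ring
  have g7 := mul_le_mul_of_nonneg_left g3 hS3.le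
  have g8 : S ^ 3 * 1 ≤ S ^ 3 * h := by gcongr
  nlinarith

end oned
section core

variable {N : ℕ}

set_option maxHeartbeats 2000000 in
lemma combine {Uii Ui ui uii fi fei c e : Fin N → ℝ}
    {τ R δ S uu h l r kK G qq qe α lam y Ut ut St : ℝ}
    (hτ : 0 < τ) (hR : 0 < R) (hδ : 0 < δ) (hS : 0 < S) (huu : 0 < uu) (hh : 1 ≤ h)
    (hl : l = h - 1) (hα : 1 ≤ α) (hy : 0 < y)
    (hT : 0 ≤ Ut - (St * (uu * h) + S * (l * ut)))
    (hX1 : ∀ i, Ui i = τ * (2 * c i / R ^ 2) / δ ^ 2 * (uu * h) + S * (l * ui i))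
    (hX2 : ∀ i, Uii i - τ * (2 / R ^ 2 / δ ^ 2 + 8 * c i ^ 2 / R ^ 4 / δ ^ 3) * (uu * h)
      - 2 * (τ * (2 * c i / R ^ 2) / δ ^ 2) * (l * ui i)
      - S * (l * uii i - ui i ^ 2 / uu) ≤ 0)
    (hui : ∀ i, ui i = S * (uu * h) * e i)
    (hUt : Ut = ∑ i, Uii i - ∑ i, (fei i * ui i + fi i * Ui i)
      + (qe * (uu * y) + qq * (S * (uu * h) * α * y)))
    (hut : ut = ∑ i, uii i - ∑ i, fi i * ui i + qq * (uu * y))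
    (s1 : ∑ i, c i ^ 2 = r ^ 2) (s2 : ∑ i, c i * e i ≤ r) (s3 : ∑ i, e i ^ 2 = 1)
    (s4 : -(G * r) - kK * r ^ 2 ≤ ∑ i, fi i * c i) (s5 : -kK ≤ ∑ i, fei i * e i)
    (hq1 : α * (y * max qq 0) ≤ lam ^ 2) (hq2 : qe * y ≤ lam ^ 3) (hlam : 0 ≤ lam) :
    0 ≤ τ * ((2 * N + 2 * (G * r) + 2 * (kK * r ^ 2)) / R ^ 2 / δ ^ 2
      + 8 * r ^ 2 / R ^ 4 / δ ^ 3)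
      - St + 2 * (h - 1) * (τ * (2 * r / R ^ 2) / δ ^ 2) * S - S ^ 3 * h
      + kK * S + lam ^ 3 + lam ^ 2 * S := by
  have hl0 : 0 ≤ l := by linarith
  set B := τ * (2 / R ^ 2) / δ ^ 2 with hB
  have hB0 : 0 < B := by positivity
  set A := τ * (8 / R ^ 4 / δ ^ 3) with hA
  set P := ∑ i, c i * e i with hP
  set Q := ∑ i, fei i * e i with hQ
  set W := ∑ i, fi i * c i with hW
  set κ := uu * h with hκ
  have hκ0 : 0 < κ := by positivity
  have t1 : ∑ i, Uii i ≤ ∑ i, (B * κ + A * κ * c i ^ 2 + 2 * B * l * S * κ * (c i * e i)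
      + S * l * uii i - S * (S * κ) ^ 2 / uu * e i ^ 2) := by
    refine Finset.sum_le_sum fun i _ => ?_
    have := hX2 i
    rw [hui i] at this
    have e1 : B * κ + A * κ * c i ^ 2 + 2 * B * l * S * κ * (c i * e i)
      + S * l * uii i - S * (S * κ) ^ 2 / uu * e i ^ 2 =
      τ * (2 / R ^ 2 / δ ^ 2 + 8 * c i ^ 2 / R ^ 4 / δ ^ 3) * κ
      + 2 * (τ * (2 * c i / R ^ 2) / δ ^ 2) * (l * (S * κ * e i))
      + S * (l * uii i - (S * κ * e i) ^ 2 / uu) := by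
      rw [hA, hB]; ring
    linarith
  have t1' : ∑ i, (B * κ + A * κ * c i ^ 2 + 2 * B * l * S * κ * (c i * e i)
      + S * l * uii i - S * (S * κ) ^ 2 / uu * e i ^ 2) = N * (B * κ) + A * κ * r ^ 2
      + 2 * B * l * S * κ * P + S * l * ∑ i, uii i - S * (S * κ) ^ 2 / uu := by
    simp only [Finset.sum_add_distrib, Finset.sum_sub_distrib, ← Finset.mul_sum, s1, s3, ← hP]
    simp
    ring
  have t2 : ∑ i, (fei i * ui i + fi i * Ui i) =
      S * κ * Q + B * κ * W + S * l * ∑ i, fi i * ui i := by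
    rw [hQ, hW, Finset.mul_sum, Finset.mul_sum, Finset.mul_sum, ← Finset.sum_add_distrib,
      ← Finset.sum_add_distrib]
    refine Finset.sum_congr rfl fun i _ => ?_
    rw [hX1 i, hui i, hB]; ring
  have t3 : 0 ≤ N * (B * κ) + A * κ * r ^ 2 + 2 * B * l * S * κ * P - S * (S * κ) ^ 2 / uu
      - S * κ * Q - B * κ * W + qe * (uu * y) + qq * y * (S * uu * (α * h - l)) - St * κ := by
    rw [hUt, hut, t2] at hT
    rw [t1'] at t1
    rw [hκ] at *
    nlinarith
  have t4 : S * (S * κ) ^ 2 / uu = κ * (S ^ 3 * h) := by rw [hκ]; field_simp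
  have t5 : qe * (uu * y) ≤ κ * lam ^ 3 := by
    have : qe * (uu * y) ≤ uu * lam ^ 3 := by nlinarith
    refine this.trans ?_
    have h3 : 0 ≤ lam ^ 3 := by positivity
    have : uu ≤ κ := le_mul_of_one_le_right huu.le hh
    nlinarith
  have t6 : qq * y * (S * uu * (α * h - l)) ≤ κ * (lam ^ 2 * S) := by
    have a1 : 0 ≤ α * h - l := by nlinarith
    have m0 : 0 ≤ max qq 0 := le_max_right _ _
    calc qq * y * (S * uu * (α * h - l)) ≤ max qq 0 * y * (S * uu * (α * h - l)) := by
          gcongr; exact le_max_left _ _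
      _ ≤ max qq 0 * y * (S * uu * (α * h)) := by gcongr; linarith
      _ = κ * (α * (y * max qq 0) * S) := by rw [hκ]; ring
      _ ≤ κ * (lam ^ 2 * S) := by gcongr
  have t7 : 2 * B * l * S * κ * P ≤ κ * (2 * B * l * S * r) := by
    have : κ * (2 * B * l * S * P) ≤ κ * (2 * B * l * S * r) := by gcongr
    linarith
  have t8 : -(S * κ * Q) ≤ κ * (kK * S) := by
    have : S * κ * (-kK) ≤ S * κ * Q := by gcongr
    linarith
  have t9 : -(B * κ * W) ≤ κ * (B * (G * r + kK * r ^ 2)) := by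
    have : B * κ * (-(G * r) - kK * r ^ 2) ≤ B * κ * W := by gcongr
    linarith
  have t10 : 0 ≤ κ * (N * B + A * r ^ 2 + 2 * B * l * S * r - S ^ 3 * h + kK * S
      + B * (G * r + kK * r ^ 2) + lam ^ 3 + lam ^ 2 * S - St) := by
    rw [t4] at t3
    linarith
  have t11 := nonneg_of_mul_nonneg_right t10 hκ0
  refine t11.trans (le_of_eq ?_)
  rw [hA, hB, hl]; ring

lemma dd_coord_sum {g : EuclideanSpace ℝ (Fin N) × ℝ → ℝ} (hg : ContDiff ℝ (⊤ : ℕ∞) g)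
    (p : EuclideanSpace ℝ (Fin N) × ℝ) (w : EuclideanSpace ℝ (Fin N)) :
    ∑ i, dd (ee N i) g p * ⟪w, EuclideanSpace.single i (1 : ℝ)⟫ = dd (w, (0 : ℝ)) g p := by
  rw [← inner_sgrad hg, inner_coord_sum]
  refine Finset.sum_congr rfl fun i _ => ?_
  rw [inner_sgrad hg]; rfl

lemma grad_f_lower {f : EuclideanSpace ℝ (Fin N) → ℝ} (hf : ContDiff ℝ (⊤ : ℕ∞) f) {k : ℝ}
    (hhess : ∀ x v, -(k * ‖v‖ ^ 2) ≤ hess f x v v) (x₀ x : EuclideanSpace ℝ (Fin N)) (t : ℝ) :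
    -(‖gradient f x₀‖ * ‖x - x₀‖) - k * ‖x - x₀‖ ^ 2 ≤
      dd (x - x₀, (0 : ℝ)) (fun z : EuclideanSpace ℝ (Fin N) × ℝ => f z.1) (x, t) := by
  have hF : ContDiff ℝ (⊤ : ℕ∞) (fun z : EuclideanSpace ℝ (Fin N) × ℝ => f z.1) :=
    hf.comp contDiff_fst
  set F := (fun z : EuclideanSpace ℝ (Fin N) × ℝ => f z.1) with hFd
  set w := x - x₀ with hw
  have hl := fun s => dd_line (w, (0 : ℝ)) (x₀, t) (dd_contDiff (w, (0 : ℝ)) hF) s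
  obtain ⟨s, -, hs⟩ := exists_hasDerivAt_eq_slope _ _ (zero_lt_one' ℝ)
    (fun s _ => (hl s).continuousAt.continuousWithinAt) (fun s _ => hl s)
  have h1 : -(k * ‖w‖ ^ 2) ≤ dd (w, (0 : ℝ)) (dd (w, (0 : ℝ)) F) ((x₀, t) + s • (w, (0 : ℝ))) := by
    have := hhess ((x₀, t) + s • (w, (0 : ℝ))).1 w
    refine this.trans (le_of_eq ?_)
    exact hess_slice hF _ w w _
  have h2 : -(‖gradient f x₀‖ * ‖w‖) ≤ dd (w, (0 : ℝ)) F (x₀, t) := by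
    rw [← inner_grad_slice hF]
    exact neg_le_of_abs_le (abs_real_inner_le_norm _ _)
  have h3 : ((x₀, t) + (1 : ℝ) • (w, (0 : ℝ)) : EuclideanSpace ℝ (Fin N) × ℝ) = (x, t) := by
    simp [hw]
  rw [hs, h3] at h1
  simp only [zero_smul, add_zero, sub_zero, div_one] at h1
  linarith

set_option maxHeartbeats 2000000 in
lemma core {f : EuclideanSpace ℝ (Fin N) → ℝ} (hf : ContDiff ℝ (⊤ : ℕ∞) f) {K : ℝ}
    (hkK : 0 ≤ ((N : ℝ) - 1) * K)
    (hhess : ∀ x v, -(((N : ℝ) - 1) * K * ‖v‖ ^ 2) ≤ hess f x v v)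
    {q u : EuclideanSpace ℝ (Fin N) × ℝ → ℝ} {α L lam a R M : ℝ} (hα : 1 ≤ α)
    (hq : ContDiff ℝ (⊤ : ℕ∞) q) (hu : ContDiff ℝ (⊤ : ℕ∞) u)
    (hpos : ∀ p ∈ halfSpace N, 0 < u p)
    (hD : ∀ p ∈ halfSpace N, Real.log (u p) ≤ L)
    (hpde : ∀ p ∈ halfSpace N, tderiv u p = swlap f u p + q p * u p ^ α)
    (hq1 : ∀ p ∈ halfSpace N, α * (u p ^ (α - 1) * max (q p) 0) ≤ lam ^ 2)
    (hq2 : ∀ p ∈ halfSpace N, ‖sgrad q p‖ * u p ^ (α - 1) ≤ lam ^ 3)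
    (hlam : 0 ≤ lam) (ha : 0 < a) (haK : 24 * (((N : ℝ) - 1) * K) ≤ a ^ 2) (hal : 4 * lam ≤ a)
    (x₀ : EuclideanSpace ℝ (Fin N)) (hR : 1 ≤ R) (haR : 16 ≤ a * R)
    (haG : 8 * (2 * N + 8 + 2 * ‖gradient f x₀‖) ≤ a ^ 2 * R)
    (x : EuclideanSpace ℝ (Fin N)) (t : ℝ) (ht : 0 < t) (hx : ‖x - x₀‖ < R) (hM : 1 ≤ M)
    (hle : ∀ p : EuclideanSpace ℝ (Fin N) × ℝ, 0 < p.2 → p.2 ≤ t → ‖p.1 - x₀‖ < R →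
      ‖sgrad u p‖ ≤ M * (a + 2 / √p.2) / (1 - ‖p.1 - x₀‖ ^ 2 / R ^ 2) *
        (u p * (1 + L - Real.log (u p))))
    (heq : ‖sgrad u (x, t)‖ = M * (a + 2 / √t) / (1 - ‖x - x₀‖ ^ 2 / R ^ 2) *
        (u (x, t) * (1 + L - Real.log (u (x, t))))) : False := by
  have hF : ContDiff ℝ (⊤ : ℕ∞) (fun z : EuclideanSpace ℝ (Fin N) × ℝ => f z.1) :=
    hf.comp contDiff_fst
  have hpde' : ∀ p ∈ halfSpace N, dd (0, (1 : ℝ)) u p = ∑ i, dd (ee N i) (dd (ee N i) u) p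
      - ∑ i, dd (ee N i) (fun z => f z.1) p * dd (ee N i) u p + q p * u p ^ α := by
    intro p hp
    rw [← tderiv_eq hu, hpde p hp, pde_dd hf hu]
  have hlow := grad_f_lower hf hhess x₀ x t
  have hhF : ∀ v, -(((N : ℝ) - 1) * K * ‖v‖ ^ 2) ≤
      dd (v, (0 : ℝ)) (dd (v, (0 : ℝ)) fun z : EuclideanSpace ℝ (Fin N) × ℝ => f z.1) (x, t) := by
    intro v
    rw [← hess_slice hF]
    exact hhess x v
  set F := (fun z : EuclideanSpace ℝ (Fin N) × ℝ => f z.1) with hFd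
  have hR0 : 0 < R := by linarith
  have hst : 0 < √t := Real.sqrt_pos.2 ht
  set p₁ : EuclideanSpace ℝ (Fin N) × ℝ := (x, t) with hp₁
  have hpH : p₁ ∈ halfSpace N := ht.le
  set w := x - x₀ with hw
  set r := ‖w‖ with hr
  have hr0 : 0 ≤ r := norm_nonneg _
  set δ := 1 - r ^ 2 / R ^ 2 with hδd
  have hδ : 0 < δ := by
    rw [hδd, sub_pos, div_lt_one (by positivity)]
    exact pow_lt_pow_left₀ hx hr0 (by norm_num)
  have hδ1 : δ ≤ 1 := by
    have : 0 ≤ r ^ 2 / R ^ 2 := by positivity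
    linarith
  set τ := M * (a + 2 / √t) with hτd
  have hτa : a ≤ τ := by
    have : 0 ≤ 2 / √t := by positivity
    nlinarith
  have hτ0 : 0 < τ := by linarith
  set S := τ / δ with hSd
  have hS0 : 0 < S := by positivity
  have hu0 : 0 < u p₁ := hpos _ hpH
  set h := 1 + L - Real.log (u p₁) with hhd
  have hh : 1 ≤ h := by have := hD _ hpH; linarith
  have hg0 : 0 < ‖sgrad u p₁‖ := by rw [heq]; positivity
  set e : EuclideanSpace ℝ (Fin N) := ‖sgrad u p₁‖⁻¹ • sgrad u p₁ with he
  have hen : ‖e‖ = 1 := by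
    rw [he, norm_smul, norm_inv, norm_norm, inv_mul_cancel₀ hg0.ne']
  have hUle : ∀ p, dd (e, (0 : ℝ)) u p ≤ ‖sgrad u p‖ := by
    intro p
    rw [← inner_sgrad hu]
    refine (real_inner_le_norm _ _).trans ?_
    rw [hen, mul_one]
  have hUeq : dd (e, (0 : ℝ)) u p₁ = S * (u p₁ * h) := by
    rw [← inner_sgrad hu, ← heq, he, real_inner_smul_right, real_inner_self_eq_norm_sq]
    field_simp
  have hgr : sgrad u p₁ = (S * (u p₁ * h)) • e := by
    rw [← heq, he, smul_smul, mul_inv_cancel₀ hg0.ne', one_smul]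
  have hui : ∀ i, dd (ee N i) u p₁ = S * (u p₁ * h) * ⟪e, EuclideanSpace.single i (1 : ℝ)⟫ := by
    intro i
    have : dd (ee N i) u p₁ = ⟪sgrad u p₁, EuclideanSpace.single i (1 : ℝ)⟫ :=
      (inner_sgrad hu p₁ _).symm
    rw [this, hgr, real_inner_smul_left]
  -- time direction
  have hT : 0 ≤ dd (0, (1 : ℝ)) (dd (e, (0 : ℝ)) u) p₁ -
      (M * (-1 / (t * √t)) / δ * (u p₁ * h) + S * ((L - Real.log (u p₁)) * dd (0, (1 : ℝ)) u p₁)) := by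
    have l0 : p₁ + (0 : ℝ) • ((0 : EuclideanSpace ℝ (Fin N)), (1 : ℝ)) = p₁ := by simp
    have l1 := dd_line (0, (1 : ℝ)) p₁ (dd_contDiff (e, (0 : ℝ)) hu) 0
    have l2 := dd_line (0, (1 : ℝ)) p₁ hu 0
    rw [l0] at l1 l2
    have l3 : HasDerivAt (fun s : ℝ => u (p₁ + s • (0, (1 : ℝ))) *
        (1 + L - Real.log (u (p₁ + s • (0, (1 : ℝ))))))
        ((L - Real.log (u p₁)) * dd (0, (1 : ℝ)) u p₁) 0 := by
      have := l2.mul ((l2.log (by rw [l0]; exact hu0.ne')).const_sub (1 + L))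
      refine this.congr_deriv ?_
      simp only [l0]
      field_simp
      ring
    have l4 : HasDerivAt (fun s : ℝ => M * (a + 2 / √(t + s)) / δ)
        (M * (-1 / (t * √t)) / δ) 0 := by
      have m1 : HasDerivAt (fun s : ℝ => √(t + s)) (1 / (2 * √(t + 0))) 0 :=
        ((hasDerivAt_id (0 : ℝ)).const_add t).sqrt (by simpa using ht.ne')
      have m2 := ((((hasDerivAt_const (0 : ℝ) (2 : ℝ)).div m1
        (by simpa using hst.ne')).const_add a).const_mul M).div_const δ
      refine m2.congr_deriv ?_
      simp only [add_zero]
      have : √t ^ 2 = t := Real.sq_sqrt ht.le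
      rw [this]
      field_simp
      ring
    have l5 := l1.sub (l4.mul l3)
    have l6 := left_test l5 (by
      have hmem : ∀ᶠ s in 𝓝[<] (0 : ℝ), -t < s :=
        mem_nhdsWithin_of_mem_nhds (lt_mem_nhds (by linarith))
      filter_upwards [hmem, self_mem_nhdsWithin] with s hs1 hs2
      have hs2' : s < 0 := hs2
      have n1 := (hUle _).trans (hle (p₁ + s • (0, (1 : ℝ))) (by simp [hp₁]; linarith)
        (by simp [hp₁]; linarith) (by simpa [hp₁] using hx))
      have n2 : (p₁ + s • ((0 : EuclideanSpace ℝ (Fin N)), (1 : ℝ))).2 = t + s := by simp [hp₁]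
      have n3 : (p₁ + s • ((0 : EuclideanSpace ℝ (Fin N)), (1 : ℝ))).1 = x := by simp [hp₁]
      rw [n2, n3] at n1
      simp only [Pi.sub_apply, Pi.mul_apply, l0, add_zero]
      rw [hUeq]
      have : M * (a + 2 / √t) / δ * (u p₁ * (1 + L - Real.log (u p₁))) = S * (u p₁ * h) := rfl
      rw [this, sub_self]
      exact sub_nonpos.2 n1)
    refine l6.trans (le_of_eq ?_)
    simp only [l0, add_zero, hSd, hτd, hhd]
  -- space directions
  have hX : ∀ i, dd (ee N i) (dd (e, (0 : ℝ)) u) p₁ =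
        τ * (2 * ⟪w, EuclideanSpace.single i (1 : ℝ)⟫ / R ^ 2) / δ ^ 2 * (u p₁ * h) +
          S * ((L - Real.log (u p₁)) * dd (ee N i) u p₁) ∧
      dd (ee N i) (dd (ee N i) (dd (e, (0 : ℝ)) u)) p₁ -
        τ * (2 / R ^ 2 / δ ^ 2 + 8 * ⟪w, EuclideanSpace.single i (1 : ℝ)⟫ ^ 2 / R ^ 4 / δ ^ 3)
          * (u p₁ * h) -
        2 * (τ * (2 * ⟪w, EuclideanSpace.single i (1 : ℝ)⟫ / R ^ 2) / δ ^ 2) *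
          ((L - Real.log (u p₁)) * dd (ee N i) u p₁) -
        S * ((L - Real.log (u p₁)) * dd (ee N i) (dd (ee N i) u) p₁
          - dd (ee N i) u p₁ ^ 2 / u p₁) ≤ 0 := by
    intro i
    set c := ⟪w, EuclideanSpace.single i (1 : ℝ)⟫ with hc
    obtain ⟨b1, b2⟩ := barrier_deriv (τ := τ) (c := c) hR0 hδ
    have l0 : p₁ + (0 : ℝ) • ee N i = p₁ := by simp
    have hnorm : ∀ s : ℝ, ‖(p₁ + s • ee N i).1 - x₀‖ ^ 2 = r ^ 2 + 2 * s * c + s ^ 2 := by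
      intro s
      have : (p₁ + s • ee N i).1 - x₀ = w + s • EuclideanSpace.single i (1 : ℝ) := by
        simp [hp₁, ee, hw]; abel
      rw [this, norm_add_sq_real, real_inner_smul_right, norm_smul]
      simp
      ring
    have key := touch (A := fun s : ℝ => dd (e, (0 : ℝ)) u (p₁ + s • ee N i))
      (w := fun s : ℝ => u (p₁ + s • ee N i)) (L := L)
      (fun s => dd_line _ _ (dd_contDiff _ hu) s)
      (dd_line _ _ (dd_contDiff _ (dd_contDiff _ hu)) 0)
      b1 b2 (fun s => dd_line _ _ hu s) (dd_line _ _ (dd_contDiff _ hu) 0)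
      (by simpa [l0] using hu0) (by
        have hev : ∀ᶠ s in 𝓝 (0 : ℝ), r ^ 2 + 2 * s * c + s ^ 2 < R ^ 2 := by
          have hcont : ContinuousAt (fun s : ℝ => r ^ 2 + 2 * s * c + s ^ 2) 0 := by fun_prop
          refine hcont.eventually (gt_mem_nhds ?_)
          simpa using pow_lt_pow_left₀ hx hr0 (by norm_num : (2 : ℕ) ≠ 0)
        filter_upwards [hev] with s hs
        have hs2 : (p₁ + s • ee N i).2 = t := by simp [hp₁, ee]
        have n1 := (hUle _).trans (hle (p₁ + s • ee N i) (by rw [hs2]; exact ht)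
          (by rw [hs2]) (by
            rw [← hnorm] at hs
            exact lt_of_pow_lt_pow_left₀ 2 hR0.le hs))
        rw [hs2, hnorm] at n1
        simp only [l0, mul_zero, zero_mul, add_zero, ne_eq, OfNat.ofNat_ne_zero,
          not_false_eq_true, zero_pow]
        rw [hUeq]
        have : τ / (1 - r ^ 2 / R ^ 2) * (u p₁ * (1 + L - Real.log (u p₁)))
          = S * (u p₁ * h) := rfl
        rw [this, sub_self]
        exact sub_nonpos.2 n1)
    simp only [l0, mul_zero, zero_mul, add_zero, ne_eq, OfNat.ofNat_ne_zero,
          not_false_eq_true, zero_pow] at key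
    exact key
  -- sums
  have hdiff := pde_diff hF hq hu hpos hpde' e p₁ hpH
  have hpd := hpde' p₁ hpH
  have s1 : ∑ i, ⟪w, EuclideanSpace.single i (1 : ℝ)⟫ ^ 2 = r ^ 2 := by
    have := inner_coord_sum w w
    rw [real_inner_self_eq_norm_sq] at this
    rw [hr, this]
    exact Finset.sum_congr rfl fun i _ => by ring
  have s2 : ∑ i, ⟪w, EuclideanSpace.single i (1 : ℝ)⟫ * ⟪e, EuclideanSpace.single i (1 : ℝ)⟫ ≤ r := by
    rw [← inner_coord_sum]
    refine (real_inner_le_norm _ _).trans ?_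
    rw [hen, mul_one]
  have s3 : ∑ i, ⟪e, EuclideanSpace.single i (1 : ℝ)⟫ ^ 2 = 1 := by
    have := inner_coord_sum e e
    rw [real_inner_self_eq_norm_sq, hen] at this
    rw [one_pow] at this
    exact Eq.trans (Finset.sum_congr rfl fun i _ => by ring) this.symm
  have s4 := dd_coord_sum hF p₁ w
  have s5 : -(((N : ℝ) - 1) * K) ≤ ∑ i, dd (e, (0 : ℝ)) (dd (ee N i) F) p₁ *
      ⟪e, EuclideanSpace.single i (1 : ℝ)⟫ := by
    have := dd_coord_sum (dd_contDiff (e, (0 : ℝ)) hF) p₁ e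
    have h2 := hhF e
    rw [hen] at h2
    rw [← this] at h2
    simp only [dd_comm (e, (0 : ℝ)) _ hF]
    linarith
  have hqe : dd (e, (0 : ℝ)) q p₁ ≤ ‖sgrad q p₁‖ := by
    rw [← inner_sgrad hq]
    refine (real_inner_le_norm _ _).trans ?_
    rw [hen, mul_one]
  have hqe2 : dd (e, (0 : ℝ)) q p₁ * u p₁ ^ (α - 1) ≤ lam ^ 3 :=
    (mul_le_mul_of_nonneg_right hqe (Real.rpow_nonneg hu0.le _)).trans (hq2 _ hpH)
  have hrp : u p₁ ^ α = u p₁ * u p₁ ^ (α - 1) := by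
    rw [Real.rpow_sub_one hu0.ne']; field_simp
  rw [hUeq, hrp] at hdiff
  rw [hrp] at hpd
  have hmain := combine (c := fun i => ⟪w, EuclideanSpace.single i (1 : ℝ)⟫)
    (e := fun i => ⟪e, EuclideanSpace.single i (1 : ℝ)⟫) hτ0 hR0 hδ hS0 hu0 hh
    (l := L - Real.log (u p₁)) (by rw [hhd]; ring) hα (Real.rpow_pos_of_pos hu0 (α - 1)) hT
    (fun i => (hX i).1) (fun i => (hX i).2) hui hdiff hpd s1 s2 s3
    (by rw [s4]; exact hlow) s5 (hq1 _ hpH) hqe2 hlam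
  refine numeric (Nat.cast_nonneg N) (norm_nonneg (gradient f x₀)) hkK hlam ha hR hr0 hx.le hδ hδ1
    hSd hτa hh haK hal haR haG le_rfl ?_ hmain
  have v1 : -(M * (-1 / (t * √t)) / δ) = M * (1 / √t) ^ 3 / δ := by
    have : t = √t ^ 2 := (Real.sq_sqrt ht.le).symm
    have h3 : t * √t = √t ^ 3 := by rw [pow_succ, ← this]
    rw [h3]
    field_simp
  rw [v1]
  have v2 : S ^ 3 / 8 = (τ / 2) ^ 3 / δ ^ 3 := by rw [hSd]; ring
  rw [v2]
  have v3 : M * (1 / √t) ≤ τ / 2 := by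
    rw [hτd]
    have : M * (a + 2 / √t) / 2 = M * (1 / √t) + M * a / 2 := by ring
    rw [this]
    have : 0 ≤ M * a / 2 := by positivity
    linarith
  have v4 : M * (1 / √t) ^ 3 ≤ (τ / 2) ^ 3 := by
    have : (M * (1 / √t)) ^ 3 ≤ (τ / 2) ^ 3 := by gcongr
    refine le_trans ?_ this
    rw [mul_pow]
    have : M ≤ M ^ 3 := le_self_pow₀ hM (by norm_num)
    gcongr
  have v5 : δ ^ 3 ≤ δ := pow_le_of_le_one hδ.le hδ1 (by norm_num)
  gcongr

end core
section est

variable {N : ℕ}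

set_option maxHeartbeats 1000000 in
lemma grad_est {f : EuclideanSpace ℝ (Fin N) → ℝ} (hf : ContDiff ℝ (⊤ : ℕ∞) f) {K : ℝ}
    (hkK : 0 ≤ ((N : ℝ) - 1) * K)
    (hhess : ∀ x v, -(((N : ℝ) - 1) * K * ‖v‖ ^ 2) ≤ hess f x v v)
    {q u : EuclideanSpace ℝ (Fin N) × ℝ → ℝ} {α L lam a : ℝ} (hα : 1 ≤ α)
    (hq : ContDiff ℝ (⊤ : ℕ∞) q) (hu : ContDiff ℝ (⊤ : ℕ∞) u)
    (hpos : ∀ p ∈ halfSpace N, 0 < u p)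
    (hD : ∀ p ∈ halfSpace N, Real.log (u p) ≤ L)
    (hpde : ∀ p ∈ halfSpace N, tderiv u p = swlap f u p + q p * u p ^ α)
    (hq1 : ∀ p ∈ halfSpace N, α * (u p ^ (α - 1) * max (q p) 0) ≤ lam ^ 2)
    (hq2 : ∀ p ∈ halfSpace N, ‖sgrad q p‖ * u p ^ (α - 1) ≤ lam ^ 3)
    (hlam : 0 ≤ lam) (ha : 0 < a) (haK : 24 * (((N : ℝ) - 1) * K) ≤ a ^ 2) (hal : 4 * lam ≤ a)
    (x₀ : EuclideanSpace ℝ (Fin N)) {T : ℝ} (hT : 0 < T) :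
    ‖sgrad u (x₀, T)‖ ≤ (a + 2 / √T) * (u (x₀, T) * (1 + L - Real.log (u (x₀, T)))) := by
  by_contra hcon
  push Not at hcon
  set G := ‖gradient f x₀‖ with hG
  have hG0 : 0 ≤ G := norm_nonneg _
  obtain ⟨R, hR, haR, haG⟩ : ∃ R : ℝ, 1 ≤ R ∧ 16 ≤ a * R ∧ 8 * (2 * N + 8 + 2 * G) ≤ a ^ 2 * R := by
    have e1 : 0 ≤ 16 / a := by positivity
    have e2 : 0 ≤ 8 * (2 * N + 8 + 2 * G) / a ^ 2 := by positivity
    refine ⟨1 + 16 / a + 8 * (2 * N + 8 + 2 * G) / a ^ 2, by linarith, ?_, ?_⟩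
    · have : a * (16 / a) = 16 := by field_simp
      nlinarith
    · have : a ^ 2 * (8 * (2 * N + 8 + 2 * G) / a ^ 2) = 8 * (2 * N + 8 + 2 * G) := by field_simp
      have h2 : 0 < a ^ 2 := by positivity
      nlinarith
  have hR0 : 0 < R := by linarith
  set κ : EuclideanSpace ℝ (Fin N) × ℝ → ℝ := fun p => u p * (1 + L - Real.log (u p)) with hκ
  have hκ0 : ∀ p ∈ halfSpace N, 0 < κ p := by
    intro p hp
    have := hD p hp
    exact mul_pos (hpos p hp) (by linarith)
  set Q : Set (EuclideanSpace ℝ (Fin N) × ℝ) := closedBall x₀ R ×ˢ Icc 0 T with hQ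
  have hQH : Q ⊆ halfSpace N := fun p hp => hp.2.1
  have hQc : IsCompact Q := (isCompact_closedBall x₀ R).prod isCompact_Icc
  set W : EuclideanSpace ℝ (Fin N) × ℝ → ℝ := fun p =>
    ‖sgrad u p‖ * (1 - ‖p.1 - x₀‖ ^ 2 / R ^ 2) * √p.2 / (κ p * (a * √p.2 + 2)) with hW
  have hden : ∀ p ∈ halfSpace N, 0 < κ p * (a * √p.2 + 2) := fun p hp =>
    mul_pos (hκ0 p hp) (by positivity)
  have hWc : ContinuousOn W Q := by
    have c1 : Continuous (sgrad u) := sgrad_continuous hu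
    have c2 : Continuous u := hu.continuous
    refine ContinuousOn.div ?_ ?_ fun p hp => (hden p (hQH hp)).ne'
    · fun_prop
    · have : ContinuousOn κ Q := by
        refine c2.continuousOn.mul (continuousOn_const.sub ?_)
        exact c2.continuousOn.log fun p hp => (hpos p (hQH hp)).ne'
      refine this.mul ?_
      fun_prop
  have hx0Q : (x₀, T) ∈ Q := ⟨by simp [hR0.le], hT.le, le_rfl⟩
  obtain ⟨p₁, hp₁, hmax⟩ := hQc.exists_isMaxOn ⟨_, hx0Q⟩ hWc
  set M := W p₁ with hM
  have hM1 : 1 < M := by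
    refine lt_of_lt_of_le ?_ (hmax hx0Q)
    have hd := hden _ (hQH hx0Q)
    have hs : 0 < √T := Real.sqrt_pos.2 hT
    rw [hW]
    simp only
    rw [lt_div_iff₀ hd]
    simp only [sub_self, norm_zero, ne_eq, OfNat.ofNat_ne_zero, not_false_eq_true, zero_pow,
      zero_div, sub_zero, mul_one, one_mul]
    have := mul_lt_mul_of_pos_right hcon hs
    refine lt_of_le_of_lt (le_of_eq ?_) this
    rw [hκ]
    field_simp
  obtain ⟨x, t⟩ := p₁
  have htH : (x, t) ∈ halfSpace N := hQH hp₁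
  have ht : 0 < t := by
    rcases (show (0 : ℝ) ≤ t from hp₁.2.1).eq_or_lt with h0 | h0
    · exfalso
      have : M = 0 := by rw [hM, hW]; simp [← h0]
      linarith
    · exact h0
  have hxR : ‖x - x₀‖ < R := by
    have hle : ‖x - x₀‖ ≤ R := by
      have := hp₁.1
      rwa [mem_closedBall, dist_eq_norm] at this
    rcases hle.eq_or_lt with h0 | h0
    · exfalso
      have : M = 0 := by
        rw [hM, hW]
        simp [h0, hR0.ne']
      linarith
    · exact h0
  have halg : ∀ p ∈ halfSpace N, 0 < p.2 → ‖p.1 - x₀‖ < R →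
      M * (a + 2 / √p.2) / (1 - ‖p.1 - x₀‖ ^ 2 / R ^ 2) * κ p =
        M * (κ p * (a * √p.2 + 2)) / ((1 - ‖p.1 - x₀‖ ^ 2 / R ^ 2) * √p.2) := by
    intro p hp h2 h3
    have hs : 0 < √p.2 := Real.sqrt_pos.2 h2
    have : M * (κ p * (a * √p.2 + 2)) = M * (a + 2 / √p.2) * κ p * √p.2 := by field_simp
    rw [this, mul_div_mul_right _ _ hs.ne']
    ring
  have hδ : ∀ p : EuclideanSpace ℝ (Fin N) × ℝ, ‖p.1 - x₀‖ < R →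
      0 < 1 - ‖p.1 - x₀‖ ^ 2 / R ^ 2 := by
    intro p hp
    rw [sub_pos, div_lt_one (by positivity)]
    exact pow_lt_pow_left₀ hp (norm_nonneg _) (by norm_num)
  refine core hf hkK hhess hα hq hu hpos hD hpde hq1 hq2 hlam ha haK hal x₀ hR haR haG x t ht hxR
    hM1.le ?_ ?_
  · intro p h1 h2 h3
    have hpH : p ∈ halfSpace N := h1.le
    have hs : 0 < √p.2 := Real.sqrt_pos.2 h1
    have hpQ : p ∈ Q := ⟨by rw [mem_closedBall, dist_eq_norm]; exact h3.le, h1.le,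
      h2.trans hp₁.2.2⟩
    have h4 : W p ≤ M := hmax hpQ
    rw [hW] at h4
    simp only at h4
    rw [div_le_iff₀ (hden p hpH)] at h4
    have := halg p hpH h1 h3
    refine le_trans ?_ (le_of_eq this.symm)
    rw [le_div_iff₀ (mul_pos (hδ p h3) hs)]
    linarith
  · have hs : 0 < √t := Real.sqrt_pos.2 ht
    have := halg (x, t) htH ht hxR
    refine Eq.trans ?_ this.symm
    rw [eq_div_iff (mul_pos (hδ (x, t) hxR) hs).ne']
    have h5 : M = ‖sgrad u (x, t)‖ * (1 - ‖x - x₀‖ ^ 2 / R ^ 2) * √t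
      / (κ (x, t) * (a * √t + 2)) := rfl
    rw [eq_div_iff (hden (x, t) htH).ne'] at h5
    simp only at h5 ⊢
    linarith

end est

/-- **Theorem 1.3, Euclidean case, `α ≥ 1`.** Harnack-type inequality for positive bounded
solutions of `∂ₜ u = Δ_f u + q uᵅ` on `ℝ^N × [0, ∞)`. -/
theorem harnack_inequality (N : ℕ) :
    ∃ C : ℝ, 0 < C ∧
      ∀ (K : ℝ), 0 ≤ K →
      ∀ (f : EuclideanSpace ℝ (Fin N) → ℝ), ContDiff ℝ (⊤ : ℕ∞) f →
      (∀ x v, -(((N : ℝ) - 1) * K * ‖v‖ ^ 2) ≤ hess f x v v) →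
      ∀ (α : ℝ), 1 ≤ α →
      ∀ (q : EuclideanSpace ℝ (Fin N) × ℝ → ℝ), ContDiff ℝ (⊤ : ℕ∞) q →
      BddAbove ((fun p => max (q p) 0) '' halfSpace N) →
      BddAbove ((fun p => ‖sgrad q p‖) '' halfSpace N) →
      ∀ (u : EuclideanSpace ℝ (Fin N) × ℝ → ℝ), ContDiff ℝ (⊤ : ℕ∞) u →
      ∀ (D : ℝ), 0 < D →
      (∀ p ∈ halfSpace N, 0 < u p) →
      (∀ p ∈ halfSpace N, u p ≤ D) →
      (∀ p ∈ halfSpace N, tderiv u p = swlap f u p + q p * u p ^ α) →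
      ∀ (x y : EuclideanSpace ℝ (Fin N)) (t : ℝ), 0 < t →
        u (y, t) ≤
          u (x, t) ^
              (Real.exp (-(C * (1 / Real.sqrt t + Real.sqrt K +
                max (Real.sqrt α * D ^ ((α - 1) / 2) * (qplusSup q) ^ ((1 : ℝ) / 2))
                    (D ^ ((α - 1) / 3) * (qgradSup q) ^ ((1 : ℝ) / 3))) * ‖x - y‖))) *
            (D * Real.exp 1) ^
              (1 - Real.exp (-(C * (1 / Real.sqrt t + Real.sqrt K +
                max (Real.sqrt α * D ^ ((α - 1) / 2) * (qplusSup q) ^ ((1 : ℝ) / 2))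
                    (D ^ ((α - 1) / 3) * (qgradSup q) ^ ((1 : ℝ) / 3))) * ‖x - y‖))) := by
  refine ⟨5 * N + 2, by positivity, ?_⟩
  intro K hK f hf hhess α hα q hq hqb hgb u hu D hD hpos huD hpde x y t ht
  set lam := max (Real.sqrt α * D ^ ((α - 1) / 2) * (qplusSup q) ^ ((1 : ℝ) / 2))
    (D ^ ((α - 1) / 3) * (qgradSup q) ^ ((1 : ℝ) / 3)) with hlamd
  have hqs : ∀ p ∈ halfSpace N, max (q p) 0 ≤ qplusSup q := fun p hp =>
    le_csSup hqb ⟨p, hp, rfl⟩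
  have hgs : ∀ p ∈ halfSpace N, ‖sgrad q p‖ ≤ qgradSup q := fun p hp =>
    le_csSup hgb ⟨p, hp, rfl⟩
  have h00 : ((0 : EuclideanSpace ℝ (Fin N)), (0 : ℝ)) ∈ halfSpace N := le_refl (0 : ℝ)
  have hqs0 : 0 ≤ qplusSup q := (le_max_right _ _).trans (hqs _ h00)
  have hgs0 : 0 ≤ qgradSup q := (norm_nonneg _).trans (hgs _ h00)
  have hα0 : 0 ≤ α := by linarith
  have hlam : 0 ≤ lam := le_max_of_le_left (by positivity)
  have hl2 : α * (D ^ (α - 1) * qplusSup q) ≤ lam ^ 2 := by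
    have h1 : (Real.sqrt α * D ^ ((α - 1) / 2) * (qplusSup q) ^ ((1 : ℝ) / 2)) ^ 2 ≤ lam ^ 2 :=
      pow_le_pow_left₀ (by positivity) (le_max_left _ _) 2
    refine le_trans (le_of_eq ?_) h1
    rw [mul_pow, mul_pow, Real.sq_sqrt hα0, ← Real.rpow_natCast (D ^ ((α - 1) / 2)),
      ← Real.rpow_natCast (qplusSup q ^ ((1 : ℝ) / 2)), ← Real.rpow_mul hD.le,
      ← Real.rpow_mul hqs0]
    norm_num
    ring
  have hl3 : qgradSup q * D ^ (α - 1) ≤ lam ^ 3 := by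
    have h1 : (D ^ ((α - 1) / 3) * (qgradSup q) ^ ((1 : ℝ) / 3)) ^ 3 ≤ lam ^ 3 :=
      pow_le_pow_left₀ (by positivity) (le_max_right _ _) 3
    refine le_trans (le_of_eq ?_) h1
    rw [mul_pow, ← Real.rpow_natCast (D ^ ((α - 1) / 3)),
      ← Real.rpow_natCast (qgradSup q ^ ((1 : ℝ) / 3)), ← Real.rpow_mul hD.le,
      ← Real.rpow_mul hgs0]
    norm_num
    ring
  have hup : ∀ p ∈ halfSpace N, u p ^ (α - 1) ≤ D ^ (α - 1) := fun p hp =>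
    Real.rpow_le_rpow (hpos p hp).le (huD p hp) (by linarith)
  have hq1 : ∀ p ∈ halfSpace N, α * (u p ^ (α - 1) * max (q p) 0) ≤ lam ^ 2 := by
    intro p hp
    refine le_trans ?_ hl2
    have := hup p hp
    have := hqs p hp
    have : 0 ≤ max (q p) 0 := le_max_right _ _
    gcongr
  have hq2 : ∀ p ∈ halfSpace N, ‖sgrad q p‖ * u p ^ (α - 1) ≤ lam ^ 3 := by
    intro p hp
    refine le_trans ?_ hl3
    have := hup p hp
    have := hgs p hp
    have : 0 ≤ u p ^ (α - 1) := Real.rpow_nonneg (hpos p hp).le _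
    gcongr
  have hlog : ∀ p ∈ halfSpace N, Real.log (u p) ≤ Real.log D := fun p hp =>
    Real.log_le_log (hpos p hp) (huD p hp)
  rcases Nat.eq_zero_or_pos N with hN | hN
  · subst hN
    have hxy : x = y := Subsingleton.elim _ _
    subst hxy
    simp
  have hN1 : (1 : ℝ) ≤ N := by exact_mod_cast hN
  set Λ := 1 / Real.sqrt t + Real.sqrt K + lam with hΛ
  have hst : 0 < √t := Real.sqrt_pos.2 ht
  have hsK : 0 ≤ √K := Real.sqrt_nonneg K
  have hest : ∀ z : EuclideanSpace ℝ (Fin N), ‖sgrad u (z, t)‖ ≤ (5 * N + 2) * Λ *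
      (u (z, t) * (1 + Real.log D - Real.log (u (z, t)))) := by
    intro z
    have hzH : (z, t) ∈ halfSpace N := ht.le
    have hu0 := hpos _ hzH
    have hk : 0 < u (z, t) * (1 + Real.log D - Real.log (u (z, t))) := by
      have := hlog _ hzH
      exact mul_pos hu0 (by linarith)
    have h1 : ‖sgrad u (z, t)‖ / (u (z, t) * (1 + Real.log D - Real.log (u (z, t)))) ≤
        5 * N * (√K + lam) + 2 / √t := by
      refine le_of_forall_pos_le_add fun ε hε => ?_
      rw [div_le_iff₀ hk]
      have := grad_est hf (mul_nonneg (by linarith) hK) hhess hα hq hu hpos hlog hpde hq1 hq2 hlam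
        (a := 5 * N * (√K + lam) + ε) (by positivity)
        (by
          have e1 : 24 * (((N : ℝ) - 1) * K) ≤ (5 * N * √K) ^ 2 := by
            rw [mul_pow, Real.sq_sqrt hK]
            have : 24 * ((N : ℝ) - 1) ≤ (5 * N) ^ 2 := by nlinarith
            nlinarith
          refine e1.trans (pow_le_pow_left₀ (by positivity) ?_ 2)
          have : 0 ≤ 5 * N * lam := by positivity
          linarith)
        (by
          have : 0 ≤ 5 * N * √K := by positivity
          nlinarith) z ht
      refine this.trans (le_of_eq ?_)
      ring
    rw [div_le_iff₀ hk] at h1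
    refine h1.trans (mul_le_mul_of_nonneg_right ?_ hk.le)
    have e1 : (5 * N + 2) * Λ - (5 * N * (√K + lam) + 2 / √t)
      = 5 * N * (1 / √t) + 2 * (√K + lam) := by rw [hΛ]; ring
    have : 0 ≤ 5 * N * (1 / √t) + 2 * (√K + lam) := by positivity
    linarith
  set A := (5 * N + 2) * Λ with hA
  have hA0 : 0 ≤ A := by positivity
  have hH : ∀ z : EuclideanSpace ℝ (Fin N), 1 ≤ 1 + Real.log D - Real.log (u (z, t)) := by
    intro z
    have := hlog (z, t) ht.le
    linarith
  have hd := (slice_contDiff hu t).differentiable (by simp)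
  have hLip := convex_univ.norm_image_sub_le_of_norm_hasFDerivWithin_le (𝕜 := ℝ) (C := A)
    (f := fun z : EuclideanSpace ℝ (Fin N) => Real.log (1 + Real.log D - Real.log (u (z, t))))
    (f' := fun z => (1 + Real.log D - Real.log (u (z, t)))⁻¹ •
      (-((u (z, t))⁻¹ • fderiv ℝ (fun z => u (z, t)) z)))
    (fun z _ => by
      have h1 := ((hd z).hasFDerivAt.log (hpos (z, t) ht.le).ne').const_sub (1 + Real.log D)
      exact (h1.log (by have := hH z; positivity)).hasFDerivWithinAt)
    (fun z _ => by
      have hu0 := hpos (z, t) ht.le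
      have hz := hH z
      have hn : ‖fderiv ℝ (fun z => u (z, t)) z‖ = ‖sgrad u (z, t)‖ := by
        unfold sgrad gradient
        simp
      rw [norm_smul, norm_neg, norm_smul, hn, norm_inv, norm_inv, Real.norm_of_nonneg hu0.le,
        Real.norm_of_nonneg (by linarith), ← mul_assoc, ← mul_inv, inv_mul_le_iff₀ (by positivity)]
      have := hest z
      linarith)
    (mem_univ y) (mem_univ x)
  have hxp := hpos (x, t) ht.le
  have hyp := hpos (y, t) ht.le
  have hle := (le_abs_self _).trans hLip
  have hGamma : Real.exp (-(A * ‖x - y‖)) * (1 + Real.log D - Real.log (u (x, t))) ≤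
      1 + Real.log D - Real.log (u (y, t)) := by
    have hx1 : 0 < 1 + Real.log D - Real.log (u (x, t)) := by linarith [hH x]
    have hy1 : 0 < 1 + Real.log D - Real.log (u (y, t)) := by linarith [hH y]
    rw [← Real.log_le_log_iff (by positivity) hy1, Real.log_mul (Real.exp_pos _).ne' hx1.ne',
      Real.log_exp]
    linarith
  set Γ := Real.exp (-(A * ‖x - y‖)) with hΓ
  rw [← Real.log_le_log_iff hyp (by positivity), Real.log_mul (by positivity) (by positivity),
    Real.log_rpow hxp, Real.log_rpow (by positivity), Real.log_mul hD.ne' (Real.exp_pos _).ne',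
    Real.log_exp]
  linarith
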